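/- For any pairwise distinct elements f₁, …, f_k of Thompson's group F, there exists p ∈ Ω₂ such that f₁ · p, …, f_k · p are pairwise distinct elements of Ω₂. -/

import Mathlib

open Set MeasureTheory Filter Topology

/-- The binary Cantor space. -/
abbrev CantorC : Type := ℕ → Bool

/-- Finite binary words. -/
abbrev BWord : Type := List Bool

/-- Prepend a finite word to an infinite binary sequence. -/
def wordApp (w : BWord) (x : CantorC) : CantorC := fun n =>
  if h : n < w.length then w.get ⟨n, h⟩ else x (n - w.length)

/-- The cylinder of sequences beginning with the word `w`. -/
def cyl (w : BWord) : Set CantorC := Set.range (wordApp w)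

/-- `J` is a code: both the α-cylinders and the β-cylinders form a partition of the
Cantor space (every point lies in the cylinder of exactly one pair). -/
def IsCode (J : Finset (BWord × BWord)) : Prop :=
  (∀ x : CantorC, ∃! p : BWord × BWord, p ∈ J ∧ x ∈ cyl p.1) ∧
  (∀ x : CantorC, ∃! p : BWord × BWord, p ∈ J ∧ x ∈ cyl p.2)

/-- `J` is order preserving: α ≺ α' lexicographically iff β ≺ β' lexicographically. -/
def OrdPres (J : Finset (BWord × BWord)) : Prop :=
  ∀ p ∈ J, ∀ q ∈ J, (List.Lex (· < ·) p.1 q.1 ↔ List.Lex (· < ·) p.2 q.2)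

/-- The bijection `g` is induced by the code `J` : it maps `β·x` to `α·x`. -/
def InducedBy (J : Finset (BWord × BWord)) (g : Equiv.Perm CantorC) : Prop :=
  ∀ p ∈ J, ∀ x : CantorC, g (wordApp p.2 x) = wordApp p.1 x

/-- `J` is an order-preserving code inducing the bijection `g`. -/
def IsCodeFor (J : Finset (BWord × BWord)) (g : Equiv.Perm CantorC) : Prop :=
  IsCode J ∧ OrdPres J ∧ InducedBy J g

/-- Membership in (the realization on the Cantor space of) Thompson's group `F`. -/
def InF (g : Equiv.Perm CantorC) : Prop := ∃ J, IsCodeFor J g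

/-- The pair `(α, β)` has `|α| ≡ |β| (mod 2)`. -/
def EvenPair (p : BWord × BWord) : Prop := p.1.length % 2 = p.2.length % 2

/-- Membership in the subgroup `H₂` : some order-preserving code for `g` has all
pairs of even length difference. -/
def InH2 (g : Equiv.Perm CantorC) : Prop :=
  ∃ J, IsCodeFor J g ∧ ∀ p ∈ J, EvenPair p

/-- The union of the α-cylinders over pairs of even length difference. -/
def pSet (J : Finset (BWord × BWord)) : Set CantorC :=
  {x | ∃ p ∈ J, EvenPair p ∧ x ∈ cyl p.1}

/-- The union of the β-cylinders over pairs of even length difference. -/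
def eSet (J : Finset (BWord × BWord)) : Set CantorC :=
  {x | ∃ p ∈ J, EvenPair p ∧ x ∈ cyl p.2}

/-- `p_f` : for `f ∈ F` this equals `pSet J` for any (equivalently, every)
order-preserving code `J` for `f`. -/
def pF (g : Equiv.Perm CantorC) : Set CantorC :=
  ⋃ J ∈ {J : Finset (BWord × BWord) | IsCodeFor J g}, pSet J

/-- `E_f` : for `f ∈ F` this equals `eSet J` for any (equivalently, every)
order-preserving code `J` for `f`. -/
def EF (g : Equiv.Perm CantorC) : Set CantorC :=
  ⋃ J ∈ {J : Finset (BWord × BWord) | IsCodeFor J g}, eSet J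

/-- `Ω₂ = {p_f : f ∈ F}`. -/
def Omega2 : Set (Set CantorC) := {p | ∃ g, InF g ∧ pF g = p}

/-- The action `f · p = f(p ∩ E_f) ∪ f((C ∖ p) ∩ (C ∖ E_f))`. -/
def actF (g : Equiv.Perm CantorC) (p : Set CantorC) : Set CantorC :=
  g '' (p ∩ EF g) ∪ g '' (pᶜ ∩ (EF g)ᶜ)

open Classical in
/-- `T(p)` as a Boolean-valued characteristic function: `T(p) w = true` iff the
cylinder of `w` meets `p`. -/
noncomputable def Tb (p : Set CantorC) : BWord → Bool :=
  fun w => if (cyl w ∩ p).Nonempty then true else false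

/-- The embedding `p ↦ (T(p), T(C ∖ p))`. -/
noncomputable def embedT (p : Set CantorC) : (BWord → Bool) × (BWord → Bool) :=
  (Tb p, Tb pᶜ)

/-- `Ω̄₂` : the closure of the image of `Ω₂` under the embedding. -/
noncomputable def OmegaBar : Set ((BWord → Bool) × (BWord → Bool)) :=
  closure (embedT '' Omega2)

/-! ### Words, cylinders and the lexicographic order -/

/-- Prepend a letter to an infinite binary sequence. -/
def seqCons (a : Bool) (x : CantorC) : CantorC
  | 0 => a
  | n + 1 => x n

theorem seqCons_eta (x : CantorC) : seqCons (x 0) (fun n => x (n + 1)) = x := by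
  funext n; cases n <;> rfl

theorem exists_seqCons (x : CantorC) : ∃ a y, x = seqCons a y :=
  ⟨x 0, fun n => x (n + 1), (seqCons_eta x).symm⟩

theorem seqCons_inj {a b : Bool} {x y : CantorC} :
    seqCons a x = seqCons b y ↔ a = b ∧ x = y := by
  constructor
  · intro h
    exact ⟨congrFun h 0, funext fun n => congrFun h (n + 1)⟩
  · rintro ⟨rfl, rfl⟩; rfl

@[simp] theorem wordApp_nil (x : CantorC) : wordApp [] x = x := by
  funext n; simp [wordApp]

@[simp] theorem wordApp_cons (a : Bool) (w : BWord) (x : CantorC) :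
    wordApp (a :: w) x = seqCons a (wordApp w x) := by
  funext n
  cases n with
  | zero => simp [wordApp, seqCons]
  | succ n => simp [wordApp, seqCons]

theorem wordApp_append (u v : BWord) (x : CantorC) :
    wordApp (u ++ v) x = wordApp u (wordApp v x) := by
  induction u with
  | nil => simp
  | cons a u ih => simp [ih]

theorem wordApp_injective (w : BWord) : Function.Injective (wordApp w) := by
  induction w with
  | nil => intro x y h; simpa using h
  | cons a w ih => intro x y h; simp only [wordApp_cons, seqCons_inj] at h; exact ih h.2

theorem wordApp_apply_of_lt (w : BWord) (x y : CantorC) {n : ℕ} (h : n < w.length) :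
    wordApp w x n = wordApp w y n := by
  simp [wordApp, h]

theorem mem_cyl_wordApp (w : BWord) (x : CantorC) : wordApp w x ∈ cyl w := ⟨x, rfl⟩

theorem eq_append_of_wordApp_eq {u v : BWord} {x y : CantorC} (h : wordApp u x = wordApp v y)
    (hl : u.length ≤ v.length) : ∃ t, v = u ++ t ∧ x = wordApp t y := by
  induction u generalizing v with
  | nil => exact ⟨v, rfl, by simpa using h⟩
  | cons a u ih =>
    cases v with
    | nil => simp at hl
    | cons b v =>
      simp only [wordApp_cons, seqCons_inj] at h
      obtain ⟨t, rfl, ht⟩ := ih h.2 (by simpa using hl)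
      exact ⟨t, by simp [h.1], ht⟩

theorem eq_of_wordApp_eq {u v : BWord} {x y : CantorC} (h : wordApp u x = wordApp v y)
    (hl : u.length = v.length) : u = v := by
  obtain ⟨t, rfl, -⟩ := eq_append_of_wordApp_eq h hl.le
  have : t = [] := by simpa using hl
  simp [this]

theorem eq_of_forall_wordApp_eq {u v : BWord} (h : ∀ x, wordApp u x = wordApp v x) : u = v := by
  wlog hl : u.length ≤ v.length generalizing u v
  · exact (this (fun x => (h x).symm) (by omega)).symm
  have key : ∀ c t, v ≠ u ++ c :: t := by
    rintro c t rfl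
    have h1 := h (fun _ => !c)
    rw [wordApp_append] at h1
    have h2 := congrFun (wordApp_injective u h1) 0
    simp [seqCons] at h2
  obtain ⟨t, ht, -⟩ := eq_append_of_wordApp_eq (h fun _ => false) hl
  cases t with
  | nil => simpa using ht.symm
  | cons c t => exact absurd ht (key c t)

theorem exists_prefix (x : CantorC) (n : ℕ) :
    ∃ w z, w.length = n ∧ x = wordApp w z := by
  induction n generalizing x with
  | zero => exact ⟨[], x, rfl, by simp⟩
  | succ n ih =>
    obtain ⟨a, y, rfl⟩ := exists_seqCons x
    obtain ⟨w, z, hw, rfl⟩ := ih y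
    exact ⟨a :: w, z, by simp [hw], by simp⟩

/-- The strict lexicographic order on infinite binary sequences. -/
def SeqLT (x y : CantorC) : Prop := ∃ n, (∀ m < n, x m = y m) ∧ x n < y n

theorem SeqLT.trichotomy (x y : CantorC) : SeqLT x y ∨ x = y ∨ SeqLT y x := by
  classical
  by_cases h : x = y
  · exact Or.inr (Or.inl h)
  · have h' : ∃ n, x n ≠ y n := Function.ne_iff.mp h
    have hm : ∀ m < Nat.find h', x m = y m := fun m hm => not_not.mp (Nat.find_min h' hm)
    rcases lt_or_gt_of_ne (Nat.find_spec h') with hl | hl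
    · exact Or.inl ⟨_, hm, hl⟩
    · exact Or.inr (Or.inr ⟨_, fun m h => (hm m h).symm, hl⟩)

theorem SeqLT.irrefl (x : CantorC) : ¬ SeqLT x x := fun ⟨_, _, h⟩ => lt_irrefl _ h

theorem SeqLT.asymm {x y : CantorC} : SeqLT x y → ¬ SeqLT y x := by
  rintro ⟨n, hn, h⟩ ⟨m, hm, h'⟩
  rcases lt_trichotomy n m with hl | rfl | hl
  · rw [hm n hl] at h; exact lt_irrefl _ h
  · exact lt_asymm h h'
  · rw [hn m hl] at h'; exact lt_irrefl _ h'

theorem seqLT_seqCons {a b : Bool} {x y : CantorC} :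
    SeqLT (seqCons a x) (seqCons b y) ↔ a < b ∨ a = b ∧ SeqLT x y := by
  constructor
  · rintro ⟨n, hn, h⟩
    cases n with
    | zero => exact Or.inl h
    | succ n => exact Or.inr ⟨hn 0 (by omega), n, fun m hm => hn (m + 1) (by omega), h⟩
  · rintro (h | ⟨rfl, n, hn, h⟩)
    · exact ⟨0, by simp, h⟩
    · refine ⟨n + 1, fun m hm => ?_, h⟩
      cases m with
      | zero => rfl
      | succ m => exact hn m (by omega)

theorem seqLT_wordApp (w : BWord) {x y : CantorC} :
    SeqLT (wordApp w x) (wordApp w y) ↔ SeqLT x y := by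
  induction w with
  | nil => simp
  | cons a w ih => simp [seqLT_seqCons, ih]

theorem lex_iff_seqLT {u v : BWord} (h : Disjoint (cyl u) (cyl v)) (x y : CantorC) :
    List.Lex (· < ·) u v ↔ SeqLT (wordApp u x) (wordApp v y) := by
  induction u generalizing v with
  | nil =>
    exact (h.ne_of_mem ⟨wordApp v y, wordApp_nil _⟩ (mem_cyl_wordApp v y) rfl).elim
  | cons a u ih =>
    cases v with
    | nil =>
      exact (h.ne_of_mem (mem_cyl_wordApp (a :: u) x)
        ⟨wordApp (a :: u) x, wordApp_nil _⟩ rfl).elim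
    | cons b v =>
      rw [wordApp_cons, wordApp_cons, seqLT_seqCons, List.cons_lex_cons_iff]
      by_cases hab : a = b
      · subst hab
        have h' : Disjoint (cyl u) (cyl v) := by
          rw [Set.disjoint_left]
          rintro _ ⟨s, rfl⟩ ⟨t, ht⟩
          exact h.ne_of_mem (mem_cyl_wordApp (a :: u) s) (mem_cyl_wordApp (a :: v) t)
            (by simp [ht])
        rw [ih h']
      · simp [hab]

theorem disjoint_cyl {u v : BWord} (hl : u.length = v.length) (h : u ≠ v) :
    Disjoint (cyl u) (cyl v) := by
  rw [Set.disjoint_left]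
  rintro _ ⟨s, rfl⟩ ⟨t, ht⟩
  exact h (eq_of_wordApp_eq ht.symm hl)

theorem isOpen_cyl (w : BWord) : IsOpen (cyl w) := by
  have : cyl w = ⋂ i : Fin w.length, {x : CantorC | x i = w.get i} := by
    ext x
    simp only [Set.mem_iInter, Set.mem_ofPred_eq]
    constructor
    · rintro ⟨z, rfl⟩ i
      simp [wordApp]
    · intro h
      refine ⟨fun n => x (n + w.length), funext fun n => ?_⟩
      by_cases hn : n < w.length
      · simpa [wordApp, hn] using (h ⟨n, hn⟩).symm
      · simp [wordApp, hn, Nat.sub_add_cancel (not_lt.mp hn)]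
  rw [this]
  exact isOpen_iInter_of_finite fun i =>
    (isOpen_discrete ({w.get i} : Set Bool)).preimage
      (continuous_apply (A := fun _ : ℕ => Bool) (i : ℕ))

/-! ### Germs: a local description of the group -/

/-- The map `g` replaces the prefix `β` by `α`. -/
def Rewrites (g : CantorC → CantorC) (β α : BWord) : Prop :=
  ∀ z, g (wordApp β z) = wordApp α z

/-- Every point has a prefix that is rewritten by `g`. -/
def IsLocallyRewriting (g : CantorC → CantorC) : Prop :=
  ∀ x, ∃ β α, x ∈ cyl β ∧ Rewrites g β α

/-- The map `g` preserves the lexicographic order. -/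
def SeqMono (g : CantorC → CantorC) : Prop := ∀ x y, SeqLT x y → SeqLT (g x) (g y)

theorem Rewrites.append {g : CantorC → CantorC} {β α : BWord} (h : Rewrites g β α) (u : BWord) :
    Rewrites g (β ++ u) (α ++ u) := fun z => by
  rw [wordApp_append, wordApp_append, h]

theorem Rewrites.length_eq {g : CantorC → CantorC} {x : CantorC} {β α β' α' : BWord}
    (h : Rewrites g β α) (h' : Rewrites g β' α') (hx : x ∈ cyl β) (hx' : x ∈ cyl β') :
    α.length + β'.length = α'.length + β.length := by
  wlog hl : β.length ≤ β'.length generalizing β α β' α'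
  · exact (this h' h hx' hx (by omega)).symm
  obtain ⟨s, rfl⟩ := hx
  obtain ⟨s', hs⟩ := hx'
  obtain ⟨u, rfl, -⟩ := eq_append_of_wordApp_eq hs.symm hl
  have := eq_of_forall_wordApp_eq fun z => (h' z).symm.trans (h.append u z)
  subst this
  simp only [List.length_append]
  omega

theorem SeqMono.lt_iff {g : Equiv.Perm CantorC} (hg : SeqMono g) {x y : CantorC} :
    SeqLT (g x) (g y) ↔ SeqLT x y := by
  refine ⟨fun h => ?_, hg x y⟩
  rcases SeqLT.trichotomy x y with h' | rfl | h'
  · exact h'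
  · exact absurd h (SeqLT.irrefl _)
  · exact absurd (hg _ _ h') (SeqLT.asymm h)

theorem SeqMono.symm {g : Equiv.Perm CantorC} (hg : SeqMono g) : SeqMono g.symm := fun x y h => by
  rw [← hg.lt_iff]; simpa using h

theorem Rewrites.symm {g : Equiv.Perm CantorC} {β α : BWord} (h : Rewrites g β α) :
    Rewrites g.symm α β := fun z => by rw [← h, Equiv.symm_apply_apply]

theorem IsLocallyRewriting.symm {g : Equiv.Perm CantorC} (hg : IsLocallyRewriting g) :
    IsLocallyRewriting g.symm := fun x => by
  obtain ⟨β, α, ⟨z, hz⟩, h⟩ := hg (g.symm x)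
  refine ⟨α, β, ⟨z, ?_⟩, h.symm⟩
  rw [← h, hz, Equiv.apply_symm_apply]

theorem IsCodeFor.exists_pair {J : Finset (BWord × BWord)} {g : Equiv.Perm CantorC}
    (h : IsCodeFor J g) (x : CantorC) : ∃ p ∈ J, x ∈ cyl p.2 ∧ Rewrites g p.2 p.1 := by
  obtain ⟨p, ⟨hp, hx⟩, -⟩ := h.1.2 x
  exact ⟨p, hp, hx, h.2.2 p hp⟩

theorem InF.isLocallyRewriting {g : Equiv.Perm CantorC} (h : InF g) : IsLocallyRewriting g := by
  obtain ⟨J, hJ⟩ := h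
  intro x
  obtain ⟨p, -, hx, hp⟩ := hJ.exists_pair x
  exact ⟨_, _, hx, hp⟩

theorem InF.seqMono {g : Equiv.Perm CantorC} (h : InF g) : SeqMono g := by
  obtain ⟨J, hJ⟩ := h
  intro x y hxy
  obtain ⟨p, hpJ, ⟨s, rfl⟩, hp⟩ := hJ.exists_pair x
  obtain ⟨q, hqJ, ⟨t, rfl⟩, hq⟩ := hJ.exists_pair y
  rw [hp, hq]
  by_cases hpq : p = q
  · subst hpq
    rwa [seqLT_wordApp] at hxy ⊢
  · have h1 : Disjoint (cyl p.1) (cyl q.1) := Set.disjoint_left.mpr fun z hz hz' =>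
      hpq ((hJ.1.1 z).unique ⟨hpJ, hz⟩ ⟨hqJ, hz'⟩)
    have h2 : Disjoint (cyl p.2) (cyl q.2) := Set.disjoint_left.mpr fun z hz hz' =>
      hpq ((hJ.1.2 z).unique ⟨hpJ, hz⟩ ⟨hqJ, hz'⟩)
    rw [← lex_iff_seqLT h1]
    rw [← lex_iff_seqLT h2] at hxy
    exact (hJ.2.1 p hpJ q hqJ).mpr hxy

theorem IsLocallyRewriting.exists_length {g : CantorC → CantorC} (hg : IsLocallyRewriting g) :
    ∃ n, ∀ w : BWord, w.length = n → ∃ α, Rewrites g w α := by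
  choose β α hx hr using hg
  obtain ⟨t, ht⟩ := isCompact_univ.elim_finite_subcover (fun x => cyl (β x))
    (fun x => isOpen_cyl _) (fun x _ => Set.mem_iUnion.mpr ⟨x, hx x⟩)
  refine ⟨t.sup fun x => (β x).length, fun w hw => ?_⟩
  obtain ⟨x, hxt, z, hz⟩ := Set.mem_iUnion₂.mp (ht (Set.mem_univ (wordApp w fun _ => false)))
  have hl : (β x).length ≤ w.length := hw ▸ Finset.le_sup (f := fun x => (β x).length) hxt
  obtain ⟨u, rfl, -⟩ := eq_append_of_wordApp_eq hz hl
  exact ⟨_, (hr x).append u⟩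

theorem InF.of_isLocallyRewriting {g : Equiv.Perm CantorC} (hl : IsLocallyRewriting g)
    (hm : SeqMono g) : InF g := by
  classical
  obtain ⟨n, hn⟩ := hl.exists_length
  choose! α hα using hn
  refine ⟨(List.finite_length_eq Bool n).toFinset.image fun w => (α w, w), ⟨?_, ?_⟩, ?_, ?_⟩
  · intro x
    obtain ⟨w, z, hw, hz⟩ := exists_prefix (g.symm x) n
    refine ⟨(α w, w), ⟨by simpa using hw, z, ?_⟩, ?_⟩
    · change wordApp (α w) z = x
      rw [← hα w hw, ← hz, Equiv.apply_symm_apply]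
    · rintro ⟨a, b⟩ ⟨hb, s, hs⟩
      obtain ⟨v, hv, hvb⟩ := Finset.mem_image.mp hb
      obtain ⟨rfl, rfl⟩ := Prod.mk.inj hvb
      have hv : v.length = n := by simpa using hv
      dsimp only at hs
      rw [← hα v hv, ← Equiv.eq_symm_apply, hz] at hs
      have hvw : v = w := eq_of_wordApp_eq hs (hv.trans hw.symm)
      rw [hvw]
  · intro x
    obtain ⟨w, z, hw, rfl⟩ := exists_prefix x n
    refine ⟨(α w, w), ⟨by simpa using hw, z, rfl⟩, ?_⟩
    rintro ⟨a, b⟩ ⟨hb, s, hs⟩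
    obtain ⟨v, hv, hvb⟩ := Finset.mem_image.mp hb
    obtain ⟨rfl, rfl⟩ := Prod.mk.inj hvb
    have hv : v.length = n := by simpa using hv
    have hvw : v = w := eq_of_wordApp_eq hs (hv.trans hw.symm)
    rw [hvw]
  · intro p hp q hq
    obtain ⟨u, hu, rfl⟩ := Finset.mem_image.mp hp
    obtain ⟨v, hv, rfl⟩ := Finset.mem_image.mp hq
    have hu : u.length = n := by simpa using hu
    have hv : v.length = n := by simpa using hv
    by_cases huv : u = v
    · subst huv
      exact iff_of_false (fun h => List.lex_irrefl (fun _ => lt_irrefl _) _ h)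
        (fun h => List.lex_irrefl (fun _ => lt_irrefl _) _ h)
    · have h2 := disjoint_cyl (hu.trans hv.symm) huv
      have h1 : Disjoint (cyl (α u)) (cyl (α v)) := by
        rw [Set.disjoint_left]
        rintro _ ⟨s, rfl⟩ ⟨t, ht⟩
        rw [← hα u hu, ← hα v hv, g.injective.eq_iff] at ht
        exact huv (eq_of_wordApp_eq ht.symm (hu.trans hv.symm))
      dsimp only
      rw [lex_iff_seqLT h1 (fun _ => false) (fun _ => false),
        lex_iff_seqLT h2 (fun _ => false) (fun _ => false), ← hα u hu, ← hα v hv, hm.lt_iff]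
  · intro p hp
    obtain ⟨u, hu, rfl⟩ := Finset.mem_image.mp hp
    exact hα u (by simpa using hu)

/-! ### The parity cocycle -/

theorem mem_EF_iff {g : Equiv.Perm CantorC} (hg : InF g) {x : CantorC} {β α : BWord}
    (hx : x ∈ cyl β) (h : Rewrites g β α) : x ∈ EF g ↔ EvenPair (α, β) := by
  simp only [EF, Set.mem_iUnion₂, eSet, Set.mem_ofPred_eq, EvenPair]
  constructor
  · rintro ⟨J, hJ, p, hp, he, hxp⟩
    have := h.length_eq (hJ.2.2 p hp) hx hxp
    omega
  · intro he
    obtain ⟨J, hJ⟩ := hg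
    obtain ⟨p, hp, hxp, hr⟩ := hJ.exists_pair x
    have := h.length_eq hr hx hxp
    exact ⟨J, hJ, p, hp, by omega, hxp⟩

theorem mem_pF_iff {g : Equiv.Perm CantorC} {y : CantorC} :
    y ∈ pF g ↔ g.symm y ∈ EF g := by
  simp only [EF, pF, Set.mem_iUnion₂, eSet, pSet, Set.mem_ofPred_eq]
  refine exists_congr fun J => exists_congr fun hJ => exists_congr fun p =>
    and_congr_right fun hp => and_congr_right fun _ => exists_congr fun z => ?_
  rw [Equiv.eq_symm_apply, hJ.2.2 p hp]

theorem mem_actF_iff {g : Equiv.Perm CantorC} {p : Set CantorC} {y : CantorC} :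
    y ∈ actF g p ↔ (g.symm y ∈ p ↔ g.symm y ∈ EF g) := by
  rw [actF, ← Set.image_union, Equiv.image_eq_preimage_symm]
  simp only [Set.mem_preimage, Set.mem_union, Set.mem_inter_iff, Set.mem_compl_iff]
  tauto

theorem Rewrites.exists_comp {f g : CantorC → CantorC} (hf : IsLocallyRewriting f)
    (hg : IsLocallyRewriting g) (x : CantorC) : ∃ β γ α, x ∈ cyl β ∧ Rewrites g β γ ∧
      Rewrites f γ α := by
  obtain ⟨β, γ, ⟨z, rfl⟩, h⟩ := hg x
  obtain ⟨γ', α, ⟨z', hz'⟩, h'⟩ := hf (g (wordApp β z))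
  obtain ⟨u, s, hu, rfl⟩ := exists_prefix z γ'.length
  rw [h, ← wordApp_append] at hz'
  obtain ⟨v, hv, -⟩ := eq_append_of_wordApp_eq hz' (by simp [hu])
  refine ⟨β ++ u, γ ++ u, α ++ v, ⟨s, by rw [wordApp_append]⟩, h.append u, ?_⟩
  rw [hv]
  exact h'.append v

theorem Rewrites.mul {f g : Equiv.Perm CantorC} {β γ α : BWord} (hg : Rewrites g β γ)
    (hf : Rewrites f γ α) : Rewrites (f * g : Equiv.Perm CantorC) β α := fun z => by
  rw [Equiv.Perm.mul_apply, hg, hf]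

theorem InF.mul {f g : Equiv.Perm CantorC} (hf : InF f) (hg : InF g) : InF (f * g) := by
  refine .of_isLocallyRewriting (fun x => ?_)
    fun x y h => hf.seqMono _ _ (hg.seqMono _ _ h)
  obtain ⟨β, γ, α, hx, h, h'⟩ :=
    Rewrites.exists_comp hf.isLocallyRewriting hg.isLocallyRewriting x
  exact ⟨β, α, hx, h.mul h'⟩

theorem mem_EF_mul {f g : Equiv.Perm CantorC} (hf : InF f) (hg : InF g) (x : CantorC) :
    x ∈ EF (f * g) ↔ (x ∈ EF g ↔ g x ∈ EF f) := by
  obtain ⟨β, γ, α, hx, h, h'⟩ :=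
    Rewrites.exists_comp hf.isLocallyRewriting hg.isLocallyRewriting x
  have hgx : g x ∈ cyl γ := by
    obtain ⟨z, rfl⟩ := hx
    exact ⟨z, (h z).symm⟩
  rw [mem_EF_iff (hf.mul hg) hx (h.mul h'), mem_EF_iff hg hx h, mem_EF_iff hf hgx h']
  simp only [EvenPair]
  omega

theorem actF_pF {f g : Equiv.Perm CantorC} (hf : InF f) (hg : InF g) :
    actF f (pF g) = pF (f * g) := by
  ext y
  rw [mem_actF_iff, mem_pF_iff, mem_pF_iff, mem_EF_mul hf hg]
  have h1 : (f * g).symm y = g.symm (f.symm y) := rfl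
  rw [h1, Equiv.apply_symm_apply]

theorem pF_mem_Omega2 {g : Equiv.Perm CantorC} (hg : InF g) : pF g ∈ Omega2 := ⟨g, hg, rfl⟩

theorem exists_cyl_pF_const {g : Equiv.Perm CantorC} (hg : InF g) (y : CantorC) :
    ∃ w, y ∈ cyl w ∧ ∀ y' ∈ cyl w, (y' ∈ pF g ↔ y ∈ pF g) := by
  obtain ⟨β, α, ⟨z, hz⟩, h⟩ := hg.isLocallyRewriting (g.symm y)
  have key : ∀ y' ∈ cyl α, (y' ∈ pF g ↔ EvenPair (α, β)) := by
    rintro _ ⟨s, rfl⟩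
    rw [mem_pF_iff, ← h, Equiv.symm_apply_apply, mem_EF_iff hg (mem_cyl_wordApp β s) h]
  have hy : y ∈ cyl α := ⟨z, by rw [← h, hz, Equiv.apply_symm_apply]⟩
  exact ⟨α, hy, fun y' hy' => (key y' hy').trans (key y hy).symm⟩

/-! ### Elements supported in a cylinder -/

/-- The generator of Thompson's group with rules `00 ↦ 0`, `01 ↦ 10`, `1 ↦ 11`. -/
def generatorX : Equiv.Perm CantorC where
  toFun x := match x 0, x 1 with
    | false, false => seqCons false fun n => x (n + 2)
    | false, true => seqCons true (seqCons false fun n => x (n + 2))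
    | true, _ => seqCons true x
  invFun x := match x 0, x 1 with
    | false, _ => seqCons false x
    | true, false => seqCons false (seqCons true fun n => x (n + 2))
    | true, true => fun n => x (n + 1)
  left_inv x := by
    obtain ⟨a, x, rfl⟩ := exists_seqCons x
    obtain ⟨b, x, rfl⟩ := exists_seqCons x
    cases a <;> cases b <;> rfl
  right_inv x := by
    obtain ⟨a, x, rfl⟩ := exists_seqCons x
    obtain ⟨b, x, rfl⟩ := exists_seqCons x
    cases a <;> cases b <;> rfl

theorem generatorX_rewrites_left : Rewrites generatorX [false, false] [false] := fun z => by
  simp only [wordApp_cons, wordApp_nil]; rfl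

theorem generatorX_rewrites_mid : Rewrites generatorX [false, true] [true, false] := fun z => by
  simp only [wordApp_cons, wordApp_nil]; rfl

theorem generatorX_rewrites_right : Rewrites generatorX [true] [true, true] := fun z => by
  simp only [wordApp_cons, wordApp_nil]; rfl

theorem generatorX_cases (x : CantorC) :
    x ∈ cyl [false, false] ∨ x ∈ cyl [false, true] ∨ x ∈ cyl [true] := by
  obtain ⟨a, x, rfl⟩ := exists_seqCons x
  obtain ⟨b, x, rfl⟩ := exists_seqCons x
  cases a
  · cases b
    · exact Or.inl ⟨x, by simp⟩
    · exact Or.inr (Or.inl ⟨x, by simp⟩)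
  · exact Or.inr (Or.inr ⟨seqCons b x, by simp⟩)

theorem generatorX_isLocallyRewriting : IsLocallyRewriting generatorX := fun x => by
  rcases generatorX_cases x with h | h | h
  · exact ⟨_, _, h, generatorX_rewrites_left⟩
  · exact ⟨_, _, h, generatorX_rewrites_mid⟩
  · exact ⟨_, _, h, generatorX_rewrites_right⟩

theorem generatorX_seqMono : SeqMono generatorX := fun x y h => by
  rcases generatorX_cases x with ⟨s, rfl⟩ | ⟨s, rfl⟩ | ⟨s, rfl⟩ <;>
  rcases generatorX_cases y with ⟨t, rfl⟩ | ⟨t, rfl⟩ | ⟨t, rfl⟩ <;>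
  simp only [generatorX_rewrites_left _, generatorX_rewrites_mid _,
    generatorX_rewrites_right _] <;>
  simp_all [seqLT_seqCons]

/-- Through every point passes the image of an odd germ of some element of the group. -/
theorem exists_odd_germ (z : CantorC) : ∃ (k : Equiv.Perm CantorC) (β α : BWord),
    IsLocallyRewriting k ∧ SeqMono k ∧ Rewrites k β α ∧ z ∈ cyl α ∧ ¬ EvenPair (α, β) := by
  obtain ⟨a, z, rfl⟩ := exists_seqCons z
  obtain ⟨b, z, rfl⟩ := exists_seqCons z
  cases a
  · exact ⟨generatorX, _, _, generatorX_isLocallyRewriting, generatorX_seqMono,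
      generatorX_rewrites_left, ⟨seqCons b z, by simp⟩, by simp [EvenPair]⟩
  · cases b
    · exact ⟨generatorX.symm, _, _, generatorX_isLocallyRewriting.symm, generatorX_seqMono.symm,
        generatorX_rewrites_right.symm, ⟨seqCons false z, by simp⟩, by simp [EvenPair]⟩
    · exact ⟨generatorX, _, _, generatorX_isLocallyRewriting, generatorX_seqMono,
        generatorX_rewrites_right, ⟨z, by simp⟩, by simp [EvenPair]⟩

theorem exists_rewrites_self {g : CantorC → CantorC} {w : BWord} (h : ∀ x ∉ cyl w, g x = x)
    {x : CantorC} (hx : x ∉ cyl w) : ∃ β, x ∈ cyl β ∧ Rewrites g β β := by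
  obtain ⟨β, z, hβ, rfl⟩ := exists_prefix x w.length
  refine ⟨β, mem_cyl_wordApp _ _, fun s => h _ fun hs => ?_⟩
  have : β ≠ w := by
    rintro rfl
    exact hx (mem_cyl_wordApp _ _)
  exact (disjoint_cyl hβ this).ne_of_mem (mem_cyl_wordApp β s) hs rfl

/-- Transport an element of the group to a cylinder, extending by the identity. -/
theorem exists_supported {k : Equiv.Perm CantorC} (hl : IsLocallyRewriting k) (hm : SeqMono k)
    (w : BWord) : ∃ K : Equiv.Perm CantorC, InF K ∧ (∀ z, K (wordApp w z) = wordApp w (k z)) ∧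
      ∀ x ∉ cyl w, K x = x := by
  classical
  let e : CantorC ≃ {x // x ∈ cyl w} := Equiv.ofInjective _ (wordApp_injective w)
  have h1 : ∀ z, k.extendDomain e (wordApp w z) = wordApp w (k z) :=
    fun z => k.extendDomain_apply_image e z
  have h2 : ∀ x ∉ cyl w, k.extendDomain e x = x :=
    fun x hx => k.extendDomain_apply_not_subtype e hx
  refine ⟨k.extendDomain e, .of_isLocallyRewriting (fun x => ?_) (fun x y h => ?_), h1, h2⟩
  · by_cases hx : x ∈ cyl w
    · obtain ⟨z, rfl⟩ := hx
      obtain ⟨β, α, ⟨s, rfl⟩, h⟩ := hl z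
      exact ⟨w ++ β, w ++ α, ⟨s, wordApp_append _ _ _⟩, fun t => by
        rw [wordApp_append, wordApp_append, h1, h]⟩
    · obtain ⟨β, hβ, h⟩ := exists_rewrites_self h2 hx
      exact ⟨β, β, hβ, h⟩
  · have move : ∀ v t, wordApp v t ∉ cyl w → v.length = w.length → Disjoint (cyl w) (cyl v) := by
      intro v t hv hl
      refine disjoint_cyl hl.symm ?_
      rintro rfl
      exact hv (mem_cyl_wordApp _ _)
    by_cases hx : x ∈ cyl w
    · by_cases hy : y ∈ cyl w
      · obtain ⟨s, rfl⟩ := hx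
        obtain ⟨t, rfl⟩ := hy
        rw [h1, h1, seqLT_wordApp]
        exact hm _ _ ((seqLT_wordApp w).mp h)
      · obtain ⟨s, rfl⟩ := hx
        rw [h1, h2 y hy]
        obtain ⟨v, t, hv, rfl⟩ := exists_prefix y w.length
        have hd := move v t hy hv
        rwa [← lex_iff_seqLT hd] at h ⊢
    · by_cases hy : y ∈ cyl w
      · obtain ⟨s, rfl⟩ := hy
        rw [h1, h2 x hx]
        obtain ⟨v, t, hv, rfl⟩ := exists_prefix x w.length
        have hd := (move v t hx hv).symm
        rwa [← lex_iff_seqLT hd] at h ⊢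
      · rwa [h2 x hx, h2 y hy]

theorem exists_long_prefix_avoiding {T : Set CantorC} (hT : T.Finite) {b : CantorC} (hb : b ∉ T)
    (n : ℕ) : ∃ w, n ≤ w.length ∧ b ∈ cyl w ∧ ∀ t ∈ T, t ∉ cyl w := by
  induction T, hT using Set.Finite.induction_on generalizing n with
  | empty =>
    obtain ⟨w, z, hw, hz⟩ := exists_prefix b n
    exact ⟨w, hw.ge, ⟨z, hz.symm⟩, by simp⟩
  | @insert a T _ _ ih =>
    have hab : b ≠ a := fun h => hb (h ▸ Set.mem_insert _ _)
    obtain ⟨m, hm⟩ := Function.ne_iff.mp hab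
    obtain ⟨w, hw, ⟨z, rfl⟩, hT⟩ := ih (fun h => hb (Set.mem_insert_of_mem _ h)) (max n (m + 1))
    refine ⟨w, by omega, mem_cyl_wordApp _ _, ?_⟩
    rintro t (rfl | ht)
    · rintro ⟨s, rfl⟩
      exact hm (wordApp_apply_of_lt w _ _ (by omega))
    · exact hT t ht

/-- The value of `p ∈ Ω₂` at a point can be switched while keeping it on a finite set. -/
theorem exists_flip {h : Equiv.Perm CantorC} (hh : InF h) {T : Set CantorC} (hT : T.Finite)
    {b : CantorC} (hb : b ∉ T) : ∃ h', InF h' ∧ (∀ t ∈ T, (t ∈ pF h' ↔ t ∈ pF h)) ∧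
      ¬ (b ∈ pF h' ↔ b ∈ pF h) := by
  obtain ⟨v, hbv, hv⟩ := exists_cyl_pF_const hh b
  obtain ⟨w, hw, ⟨z, rfl⟩, hTw⟩ := exists_long_prefix_avoiding hT hb v.length
  obtain ⟨k, β, α, hl, hm, hr, hz, hodd⟩ := exists_odd_germ z
  obtain ⟨K, hK, hKw, hKid⟩ := exists_supported hl hm w
  refine ⟨K * h, hK.mul hh, fun t ht => ?_, ?_⟩
  · obtain ⟨γ, hγ, hγr⟩ := exists_rewrites_self hKid (hTw t ht)
    have h1 : K.symm t = t := by rw [Equiv.symm_apply_eq, hKid t (hTw t ht)]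
    have h2 : t ∈ EF K := (mem_EF_iff hK hγ hγr).mpr rfl
    rw [← actF_pF hK hh, mem_actF_iff, h1]
    simp [h2]
  · obtain ⟨s, rfl⟩ := hz
    have h1 : K.symm (wordApp w (wordApp α s)) = wordApp w (wordApp β s) := by
      rw [Equiv.symm_apply_eq, hKw, hr]
    have h2 : wordApp w (wordApp β s) ∉ EF K := by
      rw [mem_EF_iff hK (β := w ++ β) (α := w ++ α) ⟨s, wordApp_append _ _ _⟩ fun t => by
        rw [wordApp_append, wordApp_append, hKw, hr]]
      simp only [EvenPair, List.length_append] at hodd ⊢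
      omega
    have h3 : wordApp w (wordApp β s) ∈ cyl v := by
      obtain ⟨t, ht⟩ := hbv
      obtain ⟨u, rfl, -⟩ := eq_append_of_wordApp_eq ht hw
      rw [wordApp_append]
      exact mem_cyl_wordApp _ _
    rw [← actF_pF hK hh, mem_actF_iff, h1, hv _ h3]
    simp [h2]

/-! ### Separating finitely many elements -/

theorem IsLocallyRewriting.exists_modulus {g : CantorC → CantorC} (hg : IsLocallyRewriting g)
    (x : CantorC) (n : ℕ) : ∃ N, ∀ y, (∀ m < N, y m = x m) → g y n = g x n := by
  obtain ⟨β, α, ⟨z, rfl⟩, h⟩ := hg x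
  refine ⟨β.length + (n + 1), fun y hy => ?_⟩
  obtain ⟨w, s, hw, rfl⟩ := exists_prefix y (β.length + (n + 1))
  obtain ⟨u, t, hu, rfl⟩ := exists_prefix z (n + 1)
  rw [← wordApp_append] at hy ⊢
  have : w = β ++ u := by
    refine List.ext_getElem (by simp [hw, hu]) fun i h1 h2 => ?_
    have h3 : i < β.length + u.length := by simpa using h2
    simpa [wordApp, h1, h3] using hy i (by omega)
  rw [this, (h.append u) s, (h.append u) t]
  exact wordApp_apply_of_lt _ _ _ (by simp [hu]; omega)

theorem infinite_setOf_ne {f g : CantorC → CantorC} (hf : IsLocallyRewriting f)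
    (hg : IsLocallyRewriting g) (h : f ≠ g) : {x | f x ≠ g x}.Infinite := by
  obtain ⟨x, hx⟩ := Function.ne_iff.mp h
  obtain ⟨n, hn⟩ := Function.ne_iff.mp hx
  obtain ⟨N, hN⟩ := hf.exists_modulus x n
  obtain ⟨M, hM⟩ := hg.exists_modulus x n
  let y : ℕ → CantorC := fun i => Function.update x (N + M + i) (!x (N + M + i))
  have hy : ∀ i, ∀ m < N + M, y i m = x m := fun i m hm =>
    Function.update_of_ne (by omega) _ _
  refine Set.infinite_of_injective_forall_mem (f := y) (fun i j hij => ?_) fun i hi => hn ?_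
  · by_contra hne
    have := congrFun hij (N + M + i)
    simp [y, hne] at this
  · rw [← hN (y i) fun m hm => hy i m (by omega), ← hM (y i) fun m hm => hy i m (by omega), hi]

/-- Two distinct elements of the group can be separated, keeping `p` on a finite set. -/
theorem exists_separating {f g h : Equiv.Perm CantorC} (hf : InF f) (hg : InF g) (hh : InF h)
    (hfg : f ≠ g) {T : Set CantorC} (hT : T.Finite) :
    ∃ h' y, InF h' ∧ (∀ t ∈ T, (t ∈ pF h' ↔ t ∈ pF h)) ∧
      ¬ (y ∈ actF f (pF h') ↔ y ∈ actF g (pF h')) := by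
  obtain ⟨b, hb, hbT⟩ := (infinite_setOf_ne hf.isLocallyRewriting hg.isLocallyRewriting
    (fun h => hfg (Equiv.coe_fn_injective h))).exists_notMem_finite hT
  by_cases hy : g b ∈ actF f (pF h) ↔ g b ∈ actF g (pF h)
  · have hab : b ≠ f.symm (g b) := fun h => hb ((Equiv.eq_symm_apply f).mp h)
    obtain ⟨h', hh', hT', hb'⟩ := exists_flip hh (hT.insert (f.symm (g b)))
      (b := b) (by simp [hab, hbT])
    refine ⟨h', g b, hh', fun t ht => hT' t (Set.mem_insert_of_mem _ ht), ?_⟩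
    have ha := hT' _ (Set.mem_insert _ _)
    simp only [mem_actF_iff, Equiv.symm_apply_apply] at hy ⊢
    tauto
  · exact ⟨h, g b, hh, fun _ _ => Iff.rfl, hy⟩

theorem exists_separating_finset {ι : Type*} {f : ι → Equiv.Perm CantorC} (hf : ∀ i, InF (f i))
    (S : Finset (ι × ι)) (hS : ∀ s ∈ S, f s.1 ≠ f s.2) :
    ∃ h, InF h ∧ ∃ T : Set CantorC, T.Finite ∧ ∀ h', InF h' →
      (∀ t ∈ T, (t ∈ pF h' ↔ t ∈ pF h)) →
      ∀ s ∈ S, actF (f s.1) (pF h') ≠ actF (f s.2) (pF h') := by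
  classical
  induction S using Finset.induction_on with
  | empty =>
    refine ⟨1, .of_isLocallyRewriting (fun x => ⟨[], [], ⟨x, wordApp_nil x⟩, fun _ => rfl⟩)
      (fun _ _ h => h), ∅, Set.finite_empty, by simp⟩
  | insert s S _ ih =>
    obtain ⟨h, hh, T, hT, hsep⟩ := ih fun s hs => hS s (Finset.mem_insert_of_mem hs)
    obtain ⟨h', y, hh', hag, hy⟩ :=
      exists_separating (hf s.1) (hf s.2) hh (hS s (Finset.mem_insert_self _ _)) hT
    refine ⟨h', hh', insert ((f s.1).symm y) (insert ((f s.2).symm y) T),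
      (hT.insert _).insert _, fun h'' hh'' hag' r hr => ?_⟩
    have hag'' : ∀ t ∈ T, (t ∈ pF h'' ↔ t ∈ pF h') := fun t ht => hag' t (by simp [ht])
    rcases Finset.mem_insert.mp hr with rfl | hr
    · intro heq
      have h1 := hag' ((f r.1).symm y) (by simp)
      have h2 := hag' ((f r.2).symm y) (by simp)
      refine hy ?_
      have h3 : y ∈ actF (f r.1) (pF h'') ↔ y ∈ actF (f r.2) (pF h'') := by rw [heq]
      rwa [mem_actF_iff, mem_actF_iff, h1, h2, ← mem_actF_iff, ← mem_actF_iff] at h3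
    · exact hsep h'' hh'' (fun t ht => (hag'' t ht).trans (hag t ht)) r hr

/-- for pairwise distinct `f₁, …, f_k ∈ F` there is `p ∈ Ω₂` with
`f₁ · p, …, f_k · p` pairwise distinct elements of `Ω₂`. -/
theorem stmt8 (k : ℕ) (f : Fin k → Equiv.Perm CantorC)
    (hf : ∀ i, InF (f i)) (hd : Function.Injective f) :
    ∃ p ∈ Omega2, (∀ i, actF (f i) p ∈ Omega2) ∧
      Function.Injective fun i => actF (f i) p := by
  obtain ⟨h, hh, T, -, hsep⟩ := exists_separating_finset hf
    (Finset.univ.filter fun s : Fin k × Fin k => s.1 ≠ s.2)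
    fun s hs => hd.ne (by simpa using hs)
  refine ⟨pF h, pF_mem_Omega2 hh, fun i => ?_, fun i j hij => ?_⟩
  · rw [actF_pF (hf i) hh]
    exact pF_mem_Omega2 ((hf i).mul hh)
  · by_contra hne
    exact hsep h hh (fun _ _ => Iff.rfl) (i, j) (by simpa using hne) hij
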